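/- arXiv:0805.2710 — 2 statements merged into one kernel-verified Lean document; each statement's English description precedes it below -/
import Mathlib

section
/- If the set 𝒪 of observable measures of f, or some generalized attractor 𝒜 ⊆ 𝒪, is finite or countably infinite, then f has a physical measure (whose basin has positive m-measure inside B(𝒜)). Conversely, if f has a physical measure μ, then either 𝒪 = {μ}, or {μ} is a proper generalized attractor of f (a proper compact subset of 𝒪 whose basin of attraction has positive m-measure). -/
open MeasureTheory Filter Set Topology
open scoped ENNReal NNReal

/-- A metric on a topological space `P` (here: the space `𝒫` of Borel probability
measures with the weak* topology) inducing its topology; `d` plays the role of `dist*`. -/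
structure CompatibleMetric (P : Type*) [TopologicalSpace P] where
  d : P → P → ℝ
  symm : ∀ x y, d x y = d y x
  triangle : ∀ x y z, d x z ≤ d x y + d y z
  eq_iff_dist_eq_zero : ∀ x y, d x y = 0 ↔ x = y
  nhds_iff : ∀ (x : P) (s : Set P), s ∈ nhds x ↔ ∃ ε > 0, {y | d x y < ε} ⊆ s

/-- The diameter of a set of measures w.r.t. the metric `D.d`. -/
noncomputable def diamD {P : Type*} [TopologicalSpace P] (D : CompatibleMetric P)
    (A : Set P) : ℝ :=
  sSup (Set.image2 D.d A A)

variable {M : Type*} [MeasurableSpace M] [TopologicalSpace M] [OpensMeasurableSpace M]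

/-- The empirical measure `σ_{n+1,x} = (1/(n+1)) ∑_{j=0}^{n} δ_{f^j(x)}`
(index shifted so that it is defined for every `n : ℕ`). -/
noncomputable def empiric (f : M → M) (x : M) (n : ℕ) : ProbabilityMeasure M :=
  ⟨((n : ℝ≥0∞) + 1)⁻¹ • ∑ j ∈ Finset.range (n + 1), Measure.dirac (f^[j] x), by
    constructor
    rw [Measure.smul_apply, Measure.finset_sum_apply]
    simp only [measure_univ, Finset.sum_const, Finset.card_range, nsmul_eq_mul, mul_one,
      smul_eq_mul]
    rw [Nat.cast_add, Nat.cast_one]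
    exact ENNReal.inv_mul_cancel (by simp)
      (ENNReal.add_ne_top.2 ⟨ENNReal.natCast_ne_top n, ENNReal.one_ne_top⟩)⟩

/-- `pω(x)`: the set of weak* limit points of the sequence of empirical measures
of the orbit of `x`. -/
def pomega (f : M → M) (x : M) : Set (ProbabilityMeasure M) :=
  {μ | MapClusterPt μ atTop (empiric f x)}

/-- The basin of attraction `B(K) = {x : pω(x) ⊆ K}` of a set of probability measures. -/
def basin (f : M → M) (K : Set (ProbabilityMeasure M)) : Set M :=
  {x | pomega f x ⊆ K}

/-- `μ` is observable: for all `ε > 0` the `ε`-basin of partial attraction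
`A_ε(μ) = {x : dist*(pω(x), μ) < ε}` has positive `m`-measure. -/
def Observable (D : CompatibleMetric (ProbabilityMeasure M)) (m : Measure M)
    (f : M → M) (μ : ProbabilityMeasure M) : Prop :=
  ∀ ε > 0, 0 < m {x | ∃ ν ∈ pomega f x, D.d ν μ < ε}

/-- `μ` is a physical measure: its basin `{x : pω(x) = {μ}}` has positive `m`-measure. -/
def PhysicalMeasure (m : Measure M) (f : M → M) (μ : ProbabilityMeasure M) : Prop :=
  0 < m {x | pomega f x = {μ}}

/-- A generalized attractor (reduction of the set `𝒪` of observable measures): a nonempty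
weak*-compact set of observable measures whose basin has positive `m`-measure. -/
def GenAttractor (D : CompatibleMetric (ProbabilityMeasure M)) (m : Measure M)
    (f : M → M) (A : Set (ProbabilityMeasure M)) : Prop :=
  A.Nonempty ∧ IsCompact A ∧ (∀ μ ∈ A, Observable D m f μ) ∧ 0 < m (basin f A)

/-- Two generalized attractors are independent if the basin of their intersection is null. -/
def IndepGA (m : Measure M) (f : M → M) (A B : Set (ProbabilityMeasure M)) : Prop :=
  m (basin f (A ∩ B)) = 0

/-- A co-chain: an (at most countable) family of pairwise independent generalized attractors. -/
def IsCochain (D : CompatibleMetric (ProbabilityMeasure M)) (m : Measure M) (f : M → M)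
    (S : Set (Set (ProbabilityMeasure M))) : Prop :=
  S.Countable ∧ (∀ A ∈ S, GenAttractor D m f A) ∧ S.Pairwise (IndepGA m f)

/-- A chain: a (finite or countably infinite) sequence, indexed by `I ⊆ ℕ`, of generalized
attractors that is strictly decreasing under inclusion. -/
def IsChainGA (D : CompatibleMetric (ProbabilityMeasure M)) (m : Measure M) (f : M → M)
    (I : Set ℕ) (c : ℕ → Set (ProbabilityMeasure M)) : Prop :=
  I.Nonempty ∧ (∀ i ∈ I, GenAttractor D m f (c i)) ∧
    ∀ i ∈ I, ∀ j ∈ I, j < i → c i ⊂ c j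

/-- Two chains are independent if each contains a member independent of some member
of the other. -/
def IndepChainPair (m : Measure M) (f : M → M)
    (p q : Set ℕ × (ℕ → Set (ProbabilityMeasure M))) : Prop :=
  (∃ i ∈ p.1, ∃ j ∈ q.1, IndepGA m f (p.2 i) (q.2 j)) ∧
    (∃ j ∈ q.1, ∃ i ∈ p.1, IndepGA m f (q.2 j) (p.2 i))

/-- `k`: the supremum of the lengths (cardinalities) of co-chains of generalized attractors. -/
noncomputable def cochainSup (D : CompatibleMetric (ProbabilityMeasure M)) (m : Measure M)
    (f : M → M) : Cardinal :=
  sSup {c : Cardinal | ∃ S, IsCochain D m f S ∧ c = Cardinal.mk S}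

/-- `h`: the supremum of the cardinalities of (at most countable) families of pairwise
independent chains of generalized attractors. -/
noncomputable def indepChainFamilySup (D : CompatibleMetric (ProbabilityMeasure M))
    (m : Measure M) (f : M → M) : Cardinal :=
  sSup {c : Cardinal | ∃ F : Set (Set ℕ × (ℕ → Set (ProbabilityMeasure M))),
    F.Countable ∧ (∀ p ∈ F, IsChainGA D m f p.1 p.2) ∧ F.Pairwise (IndepChainPair m f) ∧
    c = Cardinal.mk F}

/-- An irreducible generalized attractor: one containing no proper compact subset that is
itself a generalized attractor. -/
def IrreducibleGA (D : CompatibleMetric (ProbabilityMeasure M)) (m : Measure M) (f : M → M)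
    (A : Set (ProbabilityMeasure M)) : Prop :=
  GenAttractor D m f A ∧ ∀ K, IsCompact K → K ⊂ A → ¬ GenAttractor D m f K

/-- A real sequence with vanishing increments takes values near every point that it
crosses infinitely often. -/
theorem mapClusterPt_of_frequently_lt_of_frequently_gt {u : ℕ → ℝ} {c : ℝ}
    (hu : Tendsto (fun n => u (n + 1) - u n) atTop (𝓝 0))
    (hlt : ∃ᶠ n in atTop, u n < c) (hgt : ∃ᶠ n in atTop, c < u n) :
    MapClusterPt c atTop u := by
  rw [mapClusterPt_iff_frequently]
  intro s hs
  obtain ⟨ε, hε, hball⟩ := Metric.mem_nhds_iff.1 hs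
  rw [frequently_atTop]
  intro N
  obtain ⟨K, hK⟩ := eventually_atTop.1 (Metric.tendsto_nhds.1 hu ε hε)
  obtain ⟨p, hp, hpc⟩ := frequently_atTop.1 hlt (max N K)
  have hex : ∃ q, p ≤ q ∧ c ≤ u q := by
    obtain ⟨q, hq, hqc⟩ := frequently_atTop.1 hgt p
    exact ⟨q, hq, hqc.le⟩
  classical
  obtain ⟨hq, hqc⟩ := Nat.find_spec hex
  have hmin := fun r => @Nat.find_min _ _ hex r
  generalize Nat.find hex = q at hq hqc hmin
  obtain _ | r := q
  · obtain rfl : p = 0 := by omega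
    linarith
  have hpr : p ≤ r := by
    by_contra h
    obtain rfl : p = r + 1 := by omega
    linarith
  have hrc : u r < c := by
    by_contra! h
    exact hmin r (Nat.lt_succ_self r) ⟨hpr, h⟩
  have hstep := hK r (by omega)
  refine ⟨r + 1, by omega, hball ?_⟩
  rw [Real.dist_eq, sub_zero, abs_lt] at hstep
  rw [Metric.mem_ball, Real.dist_eq, abs_lt]
  constructor <;> linarith [hstep.1, hstep.2]

/-- In a compact space, cluster points of the image of a sequence under a continuous map
lift to cluster points of the sequence. -/
theorem MapClusterPt.exists_of_comp {ι X Y : Type*} [TopologicalSpace X] [CompactSpace X]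
    [TopologicalSpace Y] [T2Space Y] {l : Filter ι} {u : ι → X} {F : X → Y}
    (hF : Continuous F) {y : Y} (h : MapClusterPt y l (F ∘ u)) :
    ∃ x, MapClusterPt x l u ∧ F x = y := by
  obtain ⟨U, hU, hUy⟩ := mapClusterPt_iff_ultrafilter.1 h
  refine ⟨(U.map u).lim, mapClusterPt_iff_ultrafilter.2 ⟨U, hU, (U.map u).le_nhds_lim⟩, ?_⟩
  exact tendsto_nhds_unique (hF.continuousAt.tendsto.comp (U.map u).le_nhds_lim) hUy

theorem pomega_nonempty {M : Type*} [MetricSpace M] [CompactSpace M] [MeasurableSpace M]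
    [BorelSpace M] (f : M → M) (x : M) : (pomega f x).Nonempty := by
  obtain ⟨μ, -, hμ⟩ := isCompact_univ (X := ProbabilityMeasure M)
    (f := map (empiric f x) atTop) (by simp)
  exact ⟨μ, hμ⟩

theorem integral_empiric {M : Type*} [TopologicalSpace M] [MeasurableSpace M]
    [OpensMeasurableSpace M] (f : M → M) (x : M) (n : ℕ) (φ : BoundedContinuousFunction M ℝ) :
    ∫ y, φ y ∂(empiric f x n : Measure M) =
      ((n : ℝ) + 1)⁻¹ * ∑ j ∈ Finset.range (n + 1), φ (f^[j] x) := by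
  change ∫ y, φ y ∂(((n : ℝ≥0∞) + 1)⁻¹ •
    ∑ j ∈ Finset.range (n + 1), Measure.dirac (f^[j] x)) = _
  rw [integral_smul_measure, integral_finsetSum_measure fun j _ => φ.integrable _]
  have hdirac : ∀ y : M, ∫ z, φ z ∂Measure.dirac y = φ y := fun y =>
    integral_dirac' _ _ φ.continuous.measurable.stronglyMeasurable
  simp only [hdirac, smul_eq_mul]
  congr 1
  rw [ENNReal.toReal_inv, ENNReal.toReal_add (by simp) (by simp)]
  simp

theorem tendsto_integral_empiric_succ_sub {M : Type*} [TopologicalSpace M] [MeasurableSpace M]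
    [OpensMeasurableSpace M] (f : M → M) (x : M) (φ : BoundedContinuousFunction M ℝ) :
    Tendsto (fun n => ∫ y, φ y ∂(empiric f x (n + 1) : Measure M) -
      ∫ y, φ y ∂(empiric f x n : Measure M)) atTop (𝓝 0) := by
  have hlim : Tendsto (fun n : ℕ => 2 * ‖φ‖ * (1 / ((n : ℝ) + 1))) atTop (𝓝 0) := by
    simpa using tendsto_one_div_add_atTop_nhds_zero_nat.const_mul (2 * ‖φ‖)
  refine squeeze_zero_norm (fun n => ?_) hlim
  have hbound : |∫ y, φ y ∂(empiric f x n : Measure M)| ≤ ‖φ‖ := by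
    simpa using φ.norm_integral_le_norm (empiric f x n : Measure M)
  have hval : |φ (f^[n + 1] x)| ≤ ‖φ‖ := φ.norm_coe_le_norm _
  have hn : (0 : ℝ) < n + 1 := by positivity
  have hrec : ∫ y, φ y ∂(empiric f x (n + 1) : Measure M) -
      ∫ y, φ y ∂(empiric f x n : Measure M) =
      (φ (f^[n + 1] x) - ∫ y, φ y ∂(empiric f x n : Measure M)) * (1 / ((n : ℝ) + 1 + 1)) := by
    rw [integral_empiric, integral_empiric, Finset.sum_range_succ _ (n + 1)]
    push_cast
    field_simp
    ring
  rw [hrec, Real.norm_eq_abs, abs_mul, abs_of_pos (a := 1 / ((n : ℝ) + 1 + 1)) (by positivity)]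
  gcongr
  · calc |φ (f^[n + 1] x) - ∫ y, φ y ∂(empiric f x n : Measure M)|
        ≤ |φ (f^[n + 1] x)| + |∫ y, φ y ∂(empiric f x n : Measure M)| := abs_sub _ _
      _ ≤ 2 * ‖φ‖ := by linarith
  · linarith

/-- The limit set `pω(x)` takes every intermediate value of an integral functional. -/
theorem Ioo_subset_image_integral_pomega {M : Type*} [MetricSpace M] [CompactSpace M]
    [MeasurableSpace M] [BorelSpace M] (f : M → M) (x : M)
    (φ : BoundedContinuousFunction M ℝ) {μ ν : ProbabilityMeasure M}
    (hμ : μ ∈ pomega f x) (hν : ν ∈ pomega f x) :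
    Ioo (∫ y, φ y ∂(μ : Measure M)) (∫ y, φ y ∂(ν : Measure M)) ⊆
      (fun ρ : ProbabilityMeasure M => ∫ y, φ y ∂(ρ : Measure M)) '' pomega f x := by
  intro c hc
  have hF : Continuous fun ρ : ProbabilityMeasure M => ∫ y, φ y ∂(ρ : Measure M) :=
    ProbabilityMeasure.continuous_integral_boundedContinuousFunction φ
  exact MapClusterPt.exists_of_comp hF <|
    mapClusterPt_of_frequently_lt_of_frequently_gt (tendsto_integral_empiric_succ_sub f x φ)
      (MapClusterPt.frequently hμ (hF.continuousAt.eventually_lt continuousAt_const hc.1))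
      (MapClusterPt.frequently hν (continuousAt_const.eventually_lt hF.continuousAt hc.2))

theorem pomega_subsingleton_of_countable {M : Type*} [MetricSpace M] [CompactSpace M]
    [MeasurableSpace M] [BorelSpace M] {f : M → M} {x : M} (h : (pomega f x).Countable) :
    (pomega f x).Subsingleton := by
  intro μ hμ ν hν
  by_contra hne
  obtain ⟨φ, hφ⟩ : ∃ φ : BoundedContinuousFunction M ℝ,
      ∫ y, φ y ∂(μ : Measure M) ≠ ∫ y, φ y ∂(ν : Measure M) := by
    by_contra! hall
    exact hne (ProbabilityMeasure.toMeasure_injective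
      (ext_of_forall_integral_eq_of_IsFiniteMeasure hall))
  have himage := h.image fun ρ : ProbabilityMeasure M => ∫ y, φ y ∂(ρ : Measure M)
  rcases hφ.lt_or_gt with hlt | hgt
  · exact Cardinal.Real.Ioo_countable_iff.not.2 hlt.not_ge
      (himage.mono (Ioo_subset_image_integral_pomega f x φ hμ hν))
  · exact Cardinal.Real.Ioo_countable_iff.not.2 hgt.not_ge
      (himage.mono (Ioo_subset_image_integral_pomega f x φ hν hμ))

/-- A countable set of measures whose basin is non-null attracts a non-null set of points to
a single measure. -/
theorem exists_pos_measure_inter_basin_of_countable {M : Type*} [MetricSpace M]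
    [CompactSpace M] [MeasurableSpace M] [BorelSpace M] (m : Measure M) (f : M → M)
    {A : Set (ProbabilityMeasure M)} (hA : A.Countable) (hpos : 0 < m (basin f A)) :
    ∃ μ : ProbabilityMeasure M, 0 < m ({x | pomega f x = {μ}} ∩ basin f A) := by
  by_contra! h
  have hcover : basin f A ⊆ ⋃ μ ∈ A, {x | pomega f x = {μ}} ∩ basin f A := by
    intro x hx
    obtain ⟨μ, hμ⟩ := pomega_nonempty f x
    have heq : pomega f x = {μ} :=
      (pomega_subsingleton_of_countable (hA.mono hx)).eq_singleton_of_mem hμ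
    exact mem_biUnion (hx hμ) ⟨heq, hx⟩
  have hnull : m (⋃ μ ∈ A, {x | pomega f x = {μ}} ∩ basin f A) = 0 :=
    (measure_biUnion_null_iff hA).2 fun μ _ => nonpos_iff_eq_zero.1 (h μ)
  exact hpos.ne' (measure_mono_null hcover hnull)

/-- Almost every point is attracted to the set of observable measures. -/
theorem measure_compl_basin_observable {M : Type*} [MetricSpace M] [CompactSpace M]
    [MeasurableSpace M] [BorelSpace M] (D : CompatibleMetric (ProbabilityMeasure M))
    (m : Measure M) (f : M → M) : m (basin f {μ | Observable D m f μ})ᶜ = 0 := by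
  have hsc : SecondCountableTopology (ProbabilityMeasure M) := by
    let _ := TopologicalSpace.metrizableSpaceMetric (ProbabilityMeasure M)
    infer_instance
  have hnhds : ∀ μ ∈ {μ | Observable D m f μ}ᶜ, ∃ V ∈ 𝓝 μ,
      m {x | ∃ ν ∈ pomega f x, ν ∈ V} = 0 := by
    intro μ hμ
    simp only [mem_compl_iff, mem_ofPred_eq, Observable, not_forall] at hμ
    obtain ⟨ε, hε, h0⟩ := hμ
    refine ⟨{ν | D.d ν μ < ε}, (D.nhds_iff _ _).2 ⟨ε, hε, fun ν hν => ?_⟩,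
      nonpos_iff_eq_zero.1 (not_lt.1 h0)⟩
    exact (D.symm ν μ).trans_lt hν
  choose! V hV hnull using hnhds
  obtain ⟨T, hTs, hT, hcover⟩ := TopologicalSpace.countable_cover_nhdsWithin
    fun μ hμ => mem_nhdsWithin_of_mem_nhds (hV μ hμ)
  refine measure_mono_null (t := ⋃ μ ∈ T, {x | ∃ ν ∈ pomega f x, ν ∈ V μ}) ?_
    ((measure_biUnion_null_iff hT).2 fun μ hμ => hnull μ (hTs hμ))
  intro x hx
  obtain ⟨ν, hν, hνO⟩ := not_subset.1 hx
  obtain ⟨μ, hμT, hνμ⟩ := mem_iUnion₂.1 (hcover hνO)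
  exact mem_biUnion hμT ⟨ν, hν, hνμ⟩

theorem PhysicalMeasure.observable {M : Type*} [MetricSpace M] [MeasurableSpace M]
    [BorelSpace M] (D : CompatibleMetric (ProbabilityMeasure M)) {m : Measure M} {f : M → M}
    {μ : ProbabilityMeasure M} (h : PhysicalMeasure m f μ) : Observable D m f μ := by
  intro ε hε
  refine lt_of_lt_of_le h (measure_mono fun x (hx : pomega f x = {μ}) => ⟨μ, ?_, ?_⟩)
  · exact hx.superset (mem_singleton μ)
  · rwa [(D.eq_iff_dist_eq_zero μ μ).2 rfl]

/-- Cardinality of `𝒪` and physical measures: if `𝒪` or some generalized attractor `𝒜`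
is countable, then `f` has a physical measure (with basin of positive measure inside
`B(𝒜)`); conversely a physical measure `μ` yields `𝒪 = {μ}` or a proper singleton
generalized attractor `{μ}`. -/
theorem countable_attractor_gives_physical {M : Type*} [MetricSpace M] [CompactSpace M] [MeasurableSpace M] [BorelSpace M]
    (D : CompatibleMetric (ProbabilityMeasure M))
    (m : Measure M) [IsProbabilityMeasure m]
    (f : M → M) (hf : Continuous f) :
    ((∀ A : Set (ProbabilityMeasure M), GenAttractor D m f A → A.Countable →
        ∃ μ : ProbabilityMeasure M, 0 < m ({x | pomega f x = {μ}} ∩ basin f A)) ∧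
      ({μ : ProbabilityMeasure M | Observable D m f μ}.Countable →
        ∃ μ : ProbabilityMeasure M, PhysicalMeasure m f μ)) ∧
    (∀ μ : ProbabilityMeasure M, PhysicalMeasure m f μ →
      {ν : ProbabilityMeasure M | Observable D m f ν} = {μ} ∨
        (({μ} : Set (ProbabilityMeasure M)) ⊂
            {ν : ProbabilityMeasure M | Observable D m f ν} ∧
          0 < m (basin f {μ}))) := by
  refine ⟨⟨fun A hA hc => exists_pos_measure_inter_basin_of_countable m f hc hA.2.2.2,
    fun hc => ?_⟩, fun μ hμ => ?_⟩
  · have hpos : 0 < m (basin f {μ | Observable D m f μ}) := by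
      refine pos_iff_ne_zero.2 fun h0 => ?_
      have huniv : m (basin f {μ | Observable D m f μ} ∪
          (basin f {μ | Observable D m f μ})ᶜ) = 0 :=
        measure_union_null h0 (measure_compl_basin_observable D m f)
      rw [union_compl_self, measure_univ] at huniv
      exact one_ne_zero huniv
    obtain ⟨μ, hμ⟩ := exists_pos_measure_inter_basin_of_countable m f hc hpos
    exact ⟨μ, hμ.trans_le (measure_mono inter_subset_left)⟩
  · have hsub : ({μ} : Set (ProbabilityMeasure M)) ⊆ {ν | Observable D m f ν} :=
      singleton_subset_iff.2 (hμ.observable D)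
    rcases hsub.eq_or_ssubset with heq | hss
    · exact Or.inl heq.symm
    · exact Or.inr ⟨hss, hμ.trans_le
        (measure_mono fun x (hx : pomega f x = {μ}) => hx.subset)⟩
end

section
/- Suppose f has (up to countably infinitely many) irreducible generalized attractors whose basins of attraction cover m-almost every point of M, arising from a co-chain of generalized attractors whose attracting sizes sum to 1. Then: (i) these irreducible attractors are all physical measures (singletons) if and only if the diameters of the members of the co-chain are all zero; and (ii) the (finite or countably infinite) number of such irreducible generalized attractors equals both the supremum k of the lengths of co-chains of generalized attractors of f and the supremum h of the cardinalities of families of pairwise independent chains. -/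
open MeasureTheory Filter Set Topology
open scoped ENNReal NNReal

variable {M : Type*} [MeasurableSpace M] [TopologicalSpace M] [OpensMeasurableSpace M]

section CompatibleMetric

variable {P : Type*} [TopologicalSpace P]

lemma CompatibleMetric.nonneg (D : CompatibleMetric P) (x y : P) : 0 ≤ D.d x y := by
  have h := D.triangle x y x
  rw [(D.eq_iff_dist_eq_zero x x).2 rfl, D.symm y x] at h
  linarith

lemma CompatibleMetric.exists_forall_le_of_isCompact (D : CompatibleMetric P) (x : P)
    {A : Set P} (hA : IsCompact A) : ∃ C, ∀ y ∈ A, D.d x y ≤ C := by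
  refine hA.induction_on (p := fun s => ∃ C, ∀ y ∈ s, D.d x y ≤ C) ⟨0, by simp⟩ ?_ ?_ ?_
  · rintro s t hst ⟨C, hC⟩
    exact ⟨C, fun y hy => hC y (hst hy)⟩
  · rintro s t ⟨C, hC⟩ ⟨C', hC'⟩
    exact ⟨max C C', fun y hy => hy.elim (fun h => (hC y h).trans (le_max_left _ _))
      (fun h => (hC' y h).trans (le_max_right _ _))⟩
  · intro y _
    refine ⟨{z | D.d y z < 1},
      mem_nhdsWithin_of_mem_nhds ((D.nhds_iff y _).2 ⟨1, one_pos, Subset.rfl⟩),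
      D.d x y + 1, fun z hz => ?_⟩
    have hz : D.d y z < 1 := hz
    linarith [D.triangle x y z]

lemma CompatibleMetric.bddAbove_image2 (D : CompatibleMetric P) {A : Set P} (hA : IsCompact A) :
    BddAbove (image2 D.d A A) := by
  rcases A.eq_empty_or_nonempty with rfl | ⟨x, -⟩
  · simp
  · obtain ⟨C, hC⟩ := D.exists_forall_le_of_isCompact x hA
    refine ⟨C + C, ?_⟩
    rintro _ ⟨y, hy, z, hz, rfl⟩
    linarith [D.triangle y x z, D.symm y x, hC y hy, hC z hz]

@[simp]
lemma diamD_singleton (D : CompatibleMetric P) (x : P) : diamD D {x} = 0 := by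
  simp [diamD, (D.eq_iff_dist_eq_zero x x).2 rfl]

lemma subsingleton_of_diamD_eq_zero (D : CompatibleMetric P) {A : Set P} (hA : IsCompact A)
    (h : diamD D A = 0) : A.Subsingleton := by
  intro x hx y hy
  have hle : D.d x y ≤ diamD D A :=
    le_csSup (D.bddAbove_image2 hA) (mem_image2_of_mem hx hy)
  exact (D.eq_iff_dist_eq_zero x y).1 (le_antisymm (hle.trans h.le) (D.nonneg x y))

end CompatibleMetric

lemma setOf_mapClusterPt_subset_iff {P ι : Type*} [TopologicalSpace P] [CompactSpace P]
    [T2Space P] {K : Set P} (hK : IsCompact K) {l : Filter ι} {u : ι → P} :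
    {y | MapClusterPt y l u} ⊆ K ↔ Tendsto u l (𝓝ˢ K) := by
  constructor
  · intro h
    refine (hasBasis_nhdsSet K).ge_iff.2 fun U ⟨hU, hKU⟩ => ?_
    by_contra hne
    obtain ⟨y, hyU, hy⟩ := hU.isClosed_compl.isCompact.exists_mapClusterPt_of_frequently
      (not_eventually.1 hne)
    exact hyU (hKU (h hy))
  · intro h y hy
    by_contra hyK
    have hdisj : Disjoint (𝓝 y) (𝓝ˢ K) := by
      rw [← nhdsSet_singleton]
      exact (SeparatedNhds.of_isCompact_isCompact isCompact_singleton hK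
        (disjoint_singleton_left.2 hyK)).disjoint_nhdsSet
    exact (ClusterPt.mono hy h).ne hdisj.eq_bot

lemma measurableSet_setOf_tendsto_nhdsSet {X P : Type*} [MeasurableSpace X] [TopologicalSpace X]
    [OpensMeasurableSpace X] [TopologicalSpace P] [TopologicalSpace.MetrizableSpace P] {K : Set P}
    (hK : IsCompact K) {u : ℕ → X → P} (hu : ∀ n, Continuous (u n)) :
    MeasurableSet {x | Tendsto (fun n => u n x) atTop (𝓝ˢ K)} := by
  let := TopologicalSpace.metrizableSpaceMetric P
  obtain ⟨δ, -, hδ, hlim⟩ := exists_seq_strictAnti_tendsto (0 : ℝ)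
  have hbasis : (𝓝ˢ K).HasBasis (fun _ : ℕ => True) fun k => Metric.thickening (δ k) K := by
    refine (Metric.hasBasis_nhdsSet_thickening hK).to_hasBasis (fun ε hε => ?_) fun k _ =>
      ⟨δ k, hδ k, Subset.rfl⟩
    obtain ⟨k, hk⟩ := (hlim.eventually_lt_const hε).exists
    exact ⟨k, trivial, Metric.thickening_mono hk.le K⟩
  have heq : {x | Tendsto (fun n => u n x) atTop (𝓝ˢ K)} =
      ⋂ k, ⋃ N, ⋂ n ≥ N, u n ⁻¹' Metric.thickening (δ k) K := by
    ext x
    simp [hbasis.tendsto_right_iff]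
  rw [heq]
  exact .iInter fun k => .iUnion fun N => .iInter fun n => .iInter fun _ =>
    (Metric.isOpen_thickening.preimage (hu n)).measurableSet

lemma basin_inter (f : M → M) (A B : Set (ProbabilityMeasure M)) :
    basin f (A ∩ B) = basin f A ∩ basin f B := by
  ext x
  simp [basin, subset_inter_iff]

lemma basin_mono (f : M → M) {A B : Set (ProbabilityMeasure M)} (h : A ⊆ B) :
    basin f A ⊆ basin f B :=
  fun _ hx => Subset.trans hx h

lemma continuous_empiric {f : M → M} (hf : Continuous f) (n : ℕ) :
    Continuous fun x => empiric f x n := by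
  refine continuous_iff_continuousAt.2 fun x => ?_
  refine ProbabilityMeasure.tendsto_iff_forall_lintegral_tendsto.2 fun g => ?_
  have hint : ∀ y, ∫⁻ z, g z ∂(empiric f y n : Measure M) =
      ((n : ℝ≥0∞) + 1)⁻¹ * ∑ j ∈ Finset.range (n + 1), (g (f^[j] y) : ℝ≥0∞) := by
    intro y
    have hg : Measurable fun z => (g z : ℝ≥0∞) :=
      (ENNReal.continuous_coe.comp g.continuous).measurable
    simp [empiric, lintegral_dirac' _ hg]
  simp_rw [hint]
  refine ENNReal.Tendsto.const_mul ?_ (Or.inr (by simp))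
  refine (Continuous.tendsto ?_ x)
  exact continuous_finsetSum _ fun j _ =>
    ENNReal.continuous_coe.comp (g.continuous.comp (hf.iterate j))

lemma exists_forall_subset_of_finite {α : Type*} {S : Set (Set α)} (hS : S.Finite) {I : Set ℕ}
    {c : ℕ → Set α} (hI : I.Nonempty) (hc : ∀ i ∈ I, ∀ j ∈ I, j ≤ i → c i ⊆ c j)
    (h : ∀ i ∈ I, ∃ A ∈ S, A ⊆ c i) : ∃ A ∈ S, ∀ i ∈ I, A ⊆ c i := by
  by_contra! hno
  choose! g hg hgc using hno
  obtain ⟨i₀, hi₀⟩ := hI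
  have hfin : (insert i₀ (g '' S)).Finite := (hS.image g).insert i₀
  obtain ⟨i, hi, hmax⟩ := exists_max_image _ id hfin ⟨i₀, mem_insert _ _⟩
  have hiI : i ∈ I := by
    rcases hi with rfl | ⟨A, hA, rfl⟩
    exacts [hi₀, hg A hA]
  obtain ⟨A, hA, hAi⟩ := h i hiI
  exact hgc A hA (hAi.trans (hc i hiI _ (hg A hA) (hmax _ (.inr ⟨A, hA, rfl⟩))))

lemma not_indepGA_of_subset {A B C : Set (ProbabilityMeasure M)} {m : Measure M} {f : M → M}
    (hA : 0 < m (basin f A)) (hB : A ⊆ B) (hC : A ⊆ C) : ¬ IndepGA m f B C :=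
  (hA.trans_le (measure_mono (basin_mono f (subset_inter hB hC)))).ne'

lemma IsCochain.exists_indepChainFamily {D : CompatibleMetric (ProbabilityMeasure M)}
    {m : Measure M} {f : M → M} {S : Set (Set (ProbabilityMeasure M))} (hS : IsCochain D m f S) :
    ∃ F : Set (Set ℕ × (ℕ → Set (ProbabilityMeasure M))),
      F.Countable ∧ (∀ p ∈ F, IsChainGA D m f p.1 p.2) ∧ F.Pairwise (IndepChainPair m f) ∧
      Cardinal.mk S = Cardinal.mk F := by
  let φ : Set (ProbabilityMeasure M) → Set ℕ × (ℕ → Set (ProbabilityMeasure M)) :=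
    fun A => ({0}, fun _ => A)
  have hφ : Function.Injective φ := fun A B h => congrFun (congrArg Prod.snd h) 0
  refine ⟨φ '' S, hS.1.image φ, ?_, ?_, (Cardinal.mk_image_eq hφ).symm⟩
  · rintro _ ⟨A, hA, rfl⟩
    refine ⟨singleton_nonempty 0, fun _ _ => hS.2.1 A hA, fun i hi j _ hji => ?_⟩
    simp [mem_singleton_iff.1 hi] at hji
  · rintro _ ⟨A, hA, rfl⟩ _ ⟨B, hB, rfl⟩ hne
    have hAB : A ≠ B := fun h => hne (congrArg φ h)
    exact ⟨⟨0, rfl, 0, rfl, hS.2.2 hA hB hAB⟩, ⟨0, rfl, 0, rfl, hS.2.2 hB hA hAB.symm⟩⟩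

section CompactMetric

variable {X : Type*} [MetricSpace X] [CompactSpace X] [MeasurableSpace X] [BorelSpace X]
  {D : CompatibleMetric (ProbabilityMeasure X)} {m : Measure X} {f : X → X}
  {S : Set (Set (ProbabilityMeasure X))}

lemma measurableSet_basin (hf : Continuous f) {K : Set (ProbabilityMeasure X)}
    (hK : IsCompact K) : MeasurableSet (basin f K) := by
  have heq : basin f K = {x | Tendsto (empiric f x) atTop (𝓝ˢ K)} := by
    ext x
    exact setOf_mapClusterPt_subset_iff hK
  rw [heq]
  exact measurableSet_setOf_tendsto_nhdsSet hK (continuous_empiric hf)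

lemma pomega_nonempty_s14 (f : X → X) (x : X) : (pomega f x).Nonempty := by
  obtain ⟨μ, -, hμ⟩ := isCompact_univ.exists_mapClusterPt (f := atTop) (u := empiric f x) (by simp)
  exact ⟨μ, hμ⟩

lemma GenAttractor.inter {A B : Set (ProbabilityMeasure X)} (hA : GenAttractor D m f A)
    (hB : GenAttractor D m f B) (h : ¬ IndepGA m f A B) : GenAttractor D m f (A ∩ B) := by
  have hpos : 0 < m (basin f (A ∩ B)) := pos_iff_ne_zero.2 h
  obtain ⟨x, hx⟩ := nonempty_of_measure_ne_zero hpos.ne'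
  exact ⟨(pomega_nonempty_s14 f x).mono hx, hA.2.1.inter hB.2.1, fun μ hμ => hA.2.2.1 μ hμ.1, hpos⟩

lemma IrreducibleGA.subset_of_not_indepGA {A B : Set (ProbabilityMeasure X)}
    (hA : IrreducibleGA D m f A) (hB : GenAttractor D m f B) (h : ¬ IndepGA m f A B) :
    A ⊆ B := by
  by_contra hne
  have hAB := hA.1.inter hB h
  exact hA.2 _ hAB.2.1 (inter_ssubset_left_iff.2 hne) hAB

lemma GenAttractor.exists_irreducible_subset [IsProbabilityMeasure m] (hf : Continuous f)
    (hS : IsCochain D m f S) (hirr : ∀ A ∈ S, IrreducibleGA D m f A)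
    (hcov : m (⋃ A ∈ S, basin f A) = 1) {B : Set (ProbabilityMeasure X)}
    (hB : GenAttractor D m f B) : ∃ A ∈ S, A ⊆ B := by
  by_contra! hno
  have hnull : m (⋃ A ∈ S, basin f (A ∩ B)) = 0 := by
    refine (measure_biUnion_null_iff hS.1).2 fun A hA => ?_
    by_contra hne
    exact hno A hA ((hirr A hA).subset_of_not_indepGA hB hne)
  have hmeas : MeasurableSet (⋃ A ∈ S, basin f A) :=
    .biUnion hS.1 fun A hA => measurableSet_basin hf (hS.2.1 A hA).2.1
  have hcompl : m (⋃ A ∈ S, basin f A)ᶜ = 0 := (prob_compl_eq_zero_iff hmeas).2 hcov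
  refine hB.2.2.2.ne' (measure_mono_null (fun x hx => ?_) (measure_union_null hnull hcompl))
  by_cases hxU : x ∈ ⋃ A ∈ S, basin f A
  · simp only [mem_iUnion] at hxU
    obtain ⟨A, hA, hxA⟩ := hxU
    exact .inl (mem_biUnion hA (by rw [basin_inter]; exact ⟨hxA, hx⟩))
  · exact .inr hxU

lemma IsCochain.mk_le [IsProbabilityMeasure m] (hf : Continuous f) (hS : IsCochain D m f S)
    (hirr : ∀ A ∈ S, IrreducibleGA D m f A) (hcov : m (⋃ A ∈ S, basin f A) = 1)
    {T : Set (Set (ProbabilityMeasure X))} (hT : IsCochain D m f T) :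
    Cardinal.mk T ≤ Cardinal.mk S := by
  have hex : ∀ B : T, ∃ A : S, (A : Set (ProbabilityMeasure X)) ⊆ B := fun B => by
    obtain ⟨A, hA, hAB⟩ := (hT.2.1 B B.2).exists_irreducible_subset hf hS hirr hcov
    exact ⟨⟨A, hA⟩, hAB⟩
  choose g hg using hex
  refine Cardinal.mk_le_of_injective (f := g) fun B C hBC => ?_
  by_contra hne
  exact not_indepGA_of_subset (hS.2.1 _ (g B).2).2.2.2 (hg B) (hBC ▸ hg C)
    (hT.2.2 B.2 C.2 (Subtype.coe_ne_coe.2 hne))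

lemma mk_indepChainFamily_le [IsProbabilityMeasure m] (hf : Continuous f)
    (hS : IsCochain D m f S) (hirr : ∀ A ∈ S, IrreducibleGA D m f A)
    (hcov : m (⋃ A ∈ S, basin f A) = 1)
    {F : Set (Set ℕ × (ℕ → Set (ProbabilityMeasure X)))} (hFc : F.Countable)
    (hF : ∀ p ∈ F, IsChainGA D m f p.1 p.2) (hind : F.Pairwise (IndepChainPair m f)) :
    Cardinal.mk F ≤ Cardinal.mk S := by
  rcases S.finite_or_infinite with hfin | hinf
  · have hex : ∀ p : F, ∃ A : S, ∀ i ∈ p.1.1, (A : Set (ProbabilityMeasure X)) ⊆ p.1.2 i := by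
      intro p
      obtain ⟨hI, hGA, hdec⟩ := hF p p.2
      obtain ⟨A, hA, h⟩ := exists_forall_subset_of_finite hfin hI
        (fun i hi j hj hji => hji.eq_or_lt.elim (fun h => h ▸ Subset.rfl)
          fun h => (hdec i hi j hj h).subset)
        fun i hi => (hGA i hi).exists_irreducible_subset hf hS hirr hcov
      exact ⟨⟨A, hA⟩, h⟩
    choose g hg using hex
    refine Cardinal.mk_le_of_injective (f := g) fun p q hpq => ?_
    by_contra hne
    obtain ⟨⟨i, hi, j, hj, hij⟩, -⟩ := hind p.2 q.2 (Subtype.coe_ne_coe.2 hne)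
    exact not_indepGA_of_subset (hS.2.1 _ (g p).2).2.2.2 (hg p i hi) (hpq ▸ hg q j hj) hij
  · have := hinf.to_subtype
    exact (Cardinal.le_aleph0_iff_set_countable.2 hFc).trans (Cardinal.aleph0_le_mk S)

lemma physicalMeasure_iff {μ : ProbabilityMeasure X} :
    PhysicalMeasure m f μ ↔ 0 < m (basin f {μ}) := by
  have heq : basin f {μ} = {x | pomega f x = {μ}} := by
    ext x
    exact (pomega_nonempty_s14 f x).subset_singleton_iff
  rw [heq, PhysicalMeasure]

lemma GenAttractor.exists_physical_iff {A : Set (ProbabilityMeasure X)}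
    (hA : GenAttractor D m f A) :
    (∃ μ : ProbabilityMeasure X, A = {μ} ∧ PhysicalMeasure m f μ) ↔ diamD D A = 0 := by
  constructor
  · rintro ⟨μ, rfl, -⟩
    exact diamD_singleton D μ
  · intro h
    obtain ⟨μ, rfl⟩ := exists_eq_singleton_iff_nonempty_subsingleton.2
      ⟨hA.1, subsingleton_of_diamD_eq_zero D hA.2.1 h⟩
    exact ⟨μ, rfl, physicalMeasure_iff.2 hA.2.2.2⟩

end CompactMetric

/-- In the situation of a co-chain of irreducible generalized attractors whose attracting
sizes sum to `1`: (i) all members are physical measures (singletons) iff all their diameters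
vanish; (ii) their number equals both `k` and `h`. -/
theorem irreducible_cochain_card_eq_sup {M : Type*} [MetricSpace M] [CompactSpace M] [MeasurableSpace M] [BorelSpace M]
    (D : CompatibleMetric (ProbabilityMeasure M))
    (m : Measure M) [IsProbabilityMeasure m]
    (f : M → M) (hf : Continuous f)
    (S : Set (Set (ProbabilityMeasure M))) (hS : IsCochain D m f S)
    (hirr : ∀ A ∈ S, IrreducibleGA D m f A)
    (hsum : ∑' A : S, m (basin f (A : Set (ProbabilityMeasure M))) = 1)
    (hcov : m (⋃ A ∈ S, basin f A) = 1) :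
    ((∀ A ∈ S, ∃ μ : ProbabilityMeasure M, A = {μ} ∧ PhysicalMeasure m f μ) ↔
      ∀ A ∈ S, diamD D A = 0) ∧
    Cardinal.mk S = cochainSup D m f ∧
    Cardinal.mk S = indepChainFamilySup D m f := by
  refine ⟨forall₂_congr fun A hA => (hS.2.1 A hA).exists_physical_iff, ?_, ?_⟩
  · rw [cochainSup, eq_comm]
    refine IsGreatest.csSup_eq ⟨⟨S, hS, rfl⟩, ?_⟩
    rintro _ ⟨T, hT, rfl⟩
    exact hS.mk_le hf hirr hcov hT
  · rw [indepChainFamilySup, eq_comm]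
    refine IsGreatest.csSup_eq ⟨hS.exists_indepChainFamily, ?_⟩
    rintro _ ⟨F, hFc, hF, hind, rfl⟩
    exact mk_indepChainFamily_le hf hS hirr hcov hFc hF hind
end
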